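/- arXiv:0712.1328 — 6 statements merged into one kernel-verified Lean document; each statement's English description precedes it below -/
import Mathlib

section
/- Let Λ be an Artinian algebra with J(Λ)² = 0, where J(Λ) is the Jacobson radical, and let M be a finitely generated indecomposable Λ-module. If M is torsionless and M is not simple, then M is projective. -/
universe u

/-- `M` is indecomposable: nonzero and admits no nontrivial direct sum decomposition. -/
def IsIndecomposableModule (Λ : Type u) [Ring Λ] (M : Type u) [AddCommGroup M]
    [Module Λ M] : Prop :=
  Nontrivial M ∧ ∀ A B : Submodule Λ M, IsCompl A B → A = ⊥ ∨ B = ⊥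

/-- `M` is torsionless: it embeds into a finitely generated free module. -/
def IsTorsionless (Λ : Type u) [Ring Λ] (M : Type u) [AddCommGroup M]
    [Module Λ M] : Prop :=
  ∃ (n : ℕ) (f : M →ₗ[Λ] (Fin n → Λ)), Function.Injective f

/-- If `J(R)` squares to zero and `R ⧸ J(R)` is semisimple, then every left ideal not contained
in `J(R)` contains a nonzero idempotent. -/
theorem exists_idempotent_mem_of_not_le_jacobson {R : Type*} [Ring R]
    [IsSemisimpleRing (R ⧸ Ring.jacobson R)]
    (hJ : ∀ a ∈ Ring.jacobson R, ∀ b ∈ Ring.jacobson R, a * b = 0)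
    {I : Ideal R} (hI : ¬ I ≤ Ring.jacobson R) :
    ∃ e ∈ I, IsIdempotentElem e ∧ e ≠ 0 := by
  let π := Ideal.Quotient.mk (Ring.jacobson R)
  have hπ : Function.Surjective π := Ideal.Quotient.mk_surjective
  obtain ⟨e₀, he₀, hspan⟩ := IsSemisimpleRing.ideal_eq_span_idempotent (I.map π)
  obtain ⟨a, haI, rfl⟩ : ∃ a ∈ I, π a = e₀ :=
    (Ideal.mem_map_iff_of_surjective π hπ).mp (hspan ▸ Ideal.mem_span_singleton_self e₀)
  have haJ : a ∉ Ring.jacobson R := fun ha ↦ hI fun x hx ↦ by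
    have hx' := Ideal.mem_map_of_mem π hx
    rw [hspan, Ideal.Quotient.eq_zero_iff_mem.mpr ha, Ideal.span_singleton_zero] at hx'
    exact Ideal.Quotient.eq_zero_iff_mem.mp hx'
  have hz : a * a - a ∈ Ring.jacobson R := by
    rw [← Ideal.Quotient.eq_zero_iff_mem, map_sub, map_mul, sub_eq_zero]
    exact he₀
  have hzz := hJ _ hz _ hz
  refine ⟨(3 * a - 2 * a * a) * a, I.mul_mem_left _ haI, ?_, fun he ↦ haJ ?_⟩
  · have key : (3 * a - 2 * a * a) * a * ((3 * a - 2 * a * a) * a) - (3 * a - 2 * a * a) * a =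
        (4 * a * a - 4 * a - 3) * ((a * a - a) * (a * a - a)) := by
      noncomm_ring
    rwa [hzz, mul_zero, sub_eq_zero] at key
  · have key : a = (3 * a - 2 * a * a) * a + (2 * a - 1) * (a * a - a) := by
      noncomm_ring
    rw [key, he, zero_add]
    exact Ideal.mul_mem_left _ _ hz

/-- An indecomposable module with a linear functional whose range contains a nonzero idempotent
is projective. -/
theorem IsIndecomposableModule.projective_of_idempotent_mem_range {R M : Type u} [Ring R]
    [AddCommGroup M] [Module R M] (hM : IsIndecomposableModule R M) (p : M →ₗ[R] R) {e : R}
    (hep : e ∈ LinearMap.range p) (he : IsIdempotentElem e) (he0 : e ≠ 0) :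
    Module.Projective R M := by
  obtain ⟨m, rfl⟩ := hep
  set s := LinearMap.toSpanSingleton R M (p m • m) with hs
  have hp : p (p m • m) = p m := by rw [map_smul, smul_eq_mul, he.eq]
  have hidem : IsIdempotentElem (s ∘ₗ p) := by
    ext x
    simp [hs, smul_smul, he.eq, mul_assoc]
  have hfix : (s ∘ₗ p) (p m • m) = p m • m := by
    simp [hs, smul_smul, he.eq]
  have hker : LinearMap.ker (s ∘ₗ p) = ⊥ := by
    refine (hM.2 _ _ (LinearMap.IsIdempotentElem.isCompl hidem)).resolve_left fun hr ↦ he0 ?_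
    have hmem : p m • m ∈ LinearMap.range (s ∘ₗ p) := ⟨_, hfix⟩
    rw [hr, Submodule.mem_bot] at hmem
    rw [← hp, hmem, map_zero]
  refine Module.Projective.of_split p s (LinearMap.ext fun x ↦ ?_)
  exact LinearMap.ker_eq_bot.mp hker (LinearMap.congr_fun hidem x)

/-- An indecomposable semisimple module is simple. -/
theorem IsIndecomposableModule.isSimpleModule {R M : Type u} [Ring R] [AddCommGroup M]
    [Module R M] [IsSemisimpleModule R M] (hM : IsIndecomposableModule R M) :
    IsSimpleModule R M := by
  have := hM.1
  refine (isSimpleModule_iff R M).mpr { eq_bot_or_eq_top := fun A ↦ ?_ }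
  obtain ⟨B, hAB⟩ := exists_isCompl A
  exact (hM.2 A B hAB).imp_right fun hB : B = ⊥ ↦ eq_top_of_isCompl_bot (hB ▸ hAB)

theorem stmt1 (K : Type u) [Field K] (Λ : Type u) [Ring Λ] [Algebra K Λ]
    [FiniteDimensional K Λ]
    (hJ : ∀ a ∈ (⊥ : Ideal Λ).jacobson, ∀ b ∈ (⊥ : Ideal Λ).jacobson, a * b = 0)
    (M : Type u) [AddCommGroup M] [Module Λ M] [Module.Finite Λ M]
    (hind : IsIndecomposableModule Λ M) (htl : IsTorsionless Λ M)
    (hns : ¬ IsSimpleModule Λ M) :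
    Module.Projective Λ M := by
  have : IsArtinianRing Λ := IsArtinianRing.of_finite K Λ
  rw [Ideal.jacobson_bot] at hJ
  obtain ⟨n, f, hf⟩ := htl
  by_cases h : ∀ i, LinearMap.range (LinearMap.proj i ∘ₗ f) ≤ Ring.jacobson Λ
  · refine absurd ?_ hns
    have htors : Module.IsTorsionBySet Λ M (Ring.jacobson Λ) := fun x a ↦ hf <| by
      ext i
      simpa using hJ a a.2 (f x i) (h i ⟨x, rfl⟩)
    let := htors.module
    have : IsSemisimpleModule Λ M := htors.isSemisimpleModule_iff.mp inferInstance
    exact hind.isSimpleModule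
  · push Not at h
    obtain ⟨i, hi⟩ := h
    obtain ⟨e, hei, he, he0⟩ := exists_idempotent_mem_of_not_le_jacobson hJ hi
    exact hind.projective_of_idempotent_mem_range _ hei he he0
end

section
/- Let Λ be a commutative Artinian ring with J(Λ)² = 0. Then every finitely generated torsionless Λ-module M with Ext¹_Λ(M, M) = 0 is projective. -/
open CategoryTheory

universe u

noncomputable abbrev ExtGrp (Λ : Type u) [Ring Λ] (M N : ModuleCat.{u} Λ) (n : ℕ) :
    Type u :=
  ((Ext ℤ (ModuleCat.{u} Λ) n).obj (Opposite.op M)).obj N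

/-- If `Ext¹(M, N) = 0`, then every 1-cocycle with values in `N` on a projective resolution of `M`
is a coboundary. -/
theorem exists_extension_of_subsingleton_ext {Λ : Type u} [Ring Λ] (M N : ModuleCat.{u} Λ)
    (hext : Subsingleton (ExtGrp Λ M N 1)) (P : ProjectiveResolution M)
    (f : P.complex.X 1 ⟶ N) (hf : P.complex.d 2 1 ≫ f = 0) :
    ∃ h : P.complex.X 0 ⟶ N, P.complex.d 1 0 ≫ h = f := by
  have hsub : Subsingleton ((P.complex.linearYonedaObj ℤ N).homology 1) :=
    (P.isoExt (R := ℤ) 1 N).symm.toLinearEquiv.toEquiv.subsingleton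
  have hex : (P.complex.linearYonedaObj ℤ N).ExactAt 1 := by
    rw [HomologicalComplex.exactAt_iff_isZero_homology]
    exact ModuleCat.isZero_of_subsingleton _
  rw [HomologicalComplex.exactAt_iff' _ 0 1 2 (by simp) (by simp),
    ShortComplex.moduleCat_exact_iff] at hex
  exact hex f hf

section Extension

variable {R M K F F' : Type*} [CommRing R] [AddCommGroup M] [Module R M]
  [AddCommGroup K] [Module R K] [AddCommGroup F] [Module R F] [AddCommGroup F'] [Module R F']

/-- Extendability of maps from the kernel of a surjection from a projective module onto `M` does
not depend on the surjection. -/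
theorem exists_extension_ker_of_exact [Module.Projective R F] [Module.Projective R F']
    {j : K →ₗ[R] F} {π : F →ₗ[R] M} (hπ : Function.Surjective π) (hjπ : Function.Exact j π)
    {N : Type*} [AddCommGroup N] [Module R N]
    (hext : ∀ g : K →ₗ[R] N, ∃ h : F →ₗ[R] N, h ∘ₗ j = g)
    {π' : F' →ₗ[R] M} (hπ' : Function.Surjective π') (g : LinearMap.ker π' →ₗ[R] N) :
    ∃ h : F' →ₗ[R] N, h ∘ₗ (LinearMap.ker π').subtype = g := by
  obtain ⟨φ, hφ⟩ := Module.projective_lifting_property π' π hπ'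
  obtain ⟨ψ, hψ⟩ := Module.projective_lifting_property π π' hπ
  replace hφ x : π' (φ x) = π x := LinearMap.congr_fun hφ x
  replace hψ x : π (ψ x) = π' x := LinearMap.congr_fun hψ x
  let a : K →ₗ[R] LinearMap.ker π' := (φ ∘ₗ j).codRestrict _ fun c ↦ by
    simp [hφ, hjπ.apply_apply_eq_zero]
  let b : F' →ₗ[R] LinearMap.ker π' := (LinearMap.id - φ ∘ₗ ψ).codRestrict _ fun x ↦ by
    simp [hφ, hψ]
  obtain ⟨h, hh⟩ := hext (g ∘ₗ a)
  refine ⟨h ∘ₗ ψ + g ∘ₗ b, LinearMap.ext fun k ↦ ?_⟩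
  obtain ⟨c, hc⟩ := (hjπ (ψ k)).1 (by rw [hψ]; exact k.2)
  have hhc : h (j c) = g (a c) := LinearMap.congr_fun hh c
  simp only [LinearMap.comp_apply, LinearMap.add_apply, Submodule.subtype_apply, ← hc, hhc,
    ← map_add]
  congr 1
  ext
  simp [a, b, ← hc]

/-- Extendability of maps along `j` localizes when the source of `j` is finitely presented. -/
theorem exists_extension_localizedModule [Module.FinitePresentation R K] (S : Submonoid R)
    {j : K →ₗ[R] F} (hext : ∀ g : K →ₗ[R] M, ∃ h : F →ₗ[R] M, h ∘ₗ j = g)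
    (g : LocalizedModule S K →ₗ[Localization S] LocalizedModule S M) :
    ∃ h : LocalizedModule S F →ₗ[Localization S] LocalizedModule S M,
      h ∘ₗ LocalizedModule.map S j = g := by
  obtain ⟨g₀, s, hs⟩ := Module.FinitePresentation.exists_lift_of_isLocalizedModule S
    (LocalizedModule.mkLinearMap S M) (g.restrictScalars R ∘ₗ LocalizedModule.mkLinearMap S K)
  obtain ⟨h, rfl⟩ := hext g₀
  refine ⟨Localization.mk 1 s • LocalizedModule.map S h, LinearMap.ext fun x ↦ ?_⟩
  induction x using LocalizedModule.induction_on with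
  | h c t =>
    have hc : LocalizedModule.mk (h (j c)) 1 = (s : R) • g (LocalizedModule.mk c 1) :=
      LinearMap.congr_fun hs c
    have hct : LocalizedModule.mk c t = Localization.mk 1 t • LocalizedModule.mk c (1 : S) := by
      simp [LocalizedModule.mk_smul_mk]
    have hst : LocalizedModule.mk (h (j c)) (s * t) =
        Localization.mk 1 (s * t) • LocalizedModule.mk (h (j c)) (1 : S) := by
      simp [LocalizedModule.mk_smul_mk]
    have hone : Localization.mk 1 (s * t) * algebraMap R (Localization S) s =
        Localization.mk 1 t := by
      rw [← Localization.mk_one_eq_algebraMap, Localization.mk_mul, Localization.mk_eq_mk_iff,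
        Localization.r_iff_exists]
      exact ⟨1, by simp [mul_comm]⟩
    rw [LinearMap.comp_apply, LinearMap.smul_apply, LocalizedModule.map_mk,
      LocalizedModule.map_mk, LocalizedModule.mk_smul_mk, one_smul, hst, hc, hct, map_smul,
      ← algebraMap_smul (Localization S) (s : R), smul_smul, hone]

end Extension

section Local

open IsLocalRing TensorProduct

variable {R : Type*} [CommRing R] [IsLocalRing R]

/-- A finite module over a local ring is the image of a finite free module under a map whose kernel
consists of vectors with coordinates in the maximal ideal. -/
theorem IsLocalRing.exists_minimal_cover (M : Type*) [AddCommGroup M] [Module R M]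
    [Module.Finite R M] :
    ∃ (d : ℕ) (π : (Fin d → R) →ₗ[R] M), Function.Surjective π ∧
      ∀ x ∈ LinearMap.ker π, ∀ i, x i ∈ maximalIdeal R := by
  let b := Module.finBasis (ResidueField R) (ResidueField R ⊗[R] M)
  have hsurj := TensorProduct.mk_surjective R M (ResidueField R) residue_surjective
  choose f hf using fun i ↦ hsurj (b i)
  refine ⟨_, Fintype.linearCombination R f, ?_, fun x hx i ↦ ?_⟩
  · rw [← LinearMap.range_eq_top, Fintype.range_linearCombination]
    exact span_eq_top_of_tmul_eq_basis f b hf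
  · have hsum : ∑ i, residue R (x i) • b i = 0 := by
      have := congrArg (TensorProduct.mk R (ResidueField R) M 1) (LinearMap.mem_ker.1 hx)
      rw [map_zero, Fintype.linearCombination_apply, map_sum] at this
      rw [← this]
      refine Finset.sum_congr rfl fun i _ ↦ ?_
      rw [map_smul, hf]
      exact algebraMap_smul (ResidueField R) (x i) (b i)
    rw [← residue_eq_zero_iff]
    exact Fintype.linearIndependent_iff.1 b.linearIndependent _ hsum i

/-- In a module killed by the maximal ideal, a nonzero element can be sent to any element
killed by the maximal ideal. -/
theorem IsLocalRing.exists_linearMap_apply_eq {K M : Type*} [AddCommGroup K] [Module R K]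
    [AddCommGroup M] [Module R M] (hK : ∀ a ∈ maximalIdeal R, ∀ z : K, a • z = 0)
    {z : K} (hz : z ≠ 0) {y : M} (hy : ∀ a ∈ maximalIdeal R, a • y = 0) :
    ∃ g : K →ₗ[R] M, g z = y := by
  have htor : Module.IsTorsionBySet R K (maximalIdeal R) := fun x a ↦ hK a a.2 x
  let : Module (ResidueField R) K := htor.module
  have : IsScalarTower R (ResidueField R) K := htor.isScalarTower
  obtain ⟨l, hl⟩ := Module.Projective.exists_dual_ne_zero (ResidueField R) hz
  let e : ResidueField R →ₗ[R] M :=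
    (maximalIdeal R).liftQ (LinearMap.toSpanSingleton R M y) fun a ha ↦ hy a ha
  have he : e 1 = y := by
    exact (Submodule.liftQ_apply _ _ (1 : R)).trans (one_smul R y)
  exact ⟨e ∘ₗ ((l z)⁻¹ • l).restrictScalars R, by simp [hl, he]⟩

/-- Over a local ring with `𝔪² = 0`, a finite submodule of a finite free module with no
self-extensions is projective. -/
theorem IsLocalRing.projective_of_exists_extension
    (hR : ∀ a ∈ maximalIdeal R, ∀ b ∈ maximalIdeal R, a * b = 0)
    {M N : Type*} [AddCommGroup M] [Module R M] [Module.Finite R M]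
    [AddCommGroup N] [Module R N] [Module.Finite R N] [Module.Free R N]
    (i : M →ₗ[R] N) (hi : Function.Injective i)
    (hext : ∀ (d : ℕ) (π : (Fin d → R) →ₗ[R] M), Function.Surjective π →
      ∀ g : LinearMap.ker π →ₗ[R] M,
        ∃ h : (Fin d → R) →ₗ[R] M, h ∘ₗ (LinearMap.ker π).subtype = g) :
    Module.Projective R M := by
  obtain ⟨d, π, hπ, hker⟩ := exists_minimal_cover (R := R) M
  by_cases hbot : LinearMap.ker π = ⊥
  · exact .of_equiv (LinearEquiv.ofBijective π ⟨LinearMap.ker_eq_bot.1 hbot, hπ⟩)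
  obtain ⟨z, hzπ, hz⟩ := Submodule.exists_mem_ne_zero_of_ne_bot hbot
  have hsoc (y : M) (hy : ∀ a ∈ maximalIdeal R, a • y = 0) :
      y ∈ maximalIdeal R • (⊤ : Submodule R M) := by
    obtain ⟨g, hg⟩ := exists_linearMap_apply_eq (K := LinearMap.ker π) (z := ⟨z, hzπ⟩)
      (fun a ha x ↦ by ext k; exact hR a ha _ (hker x x.2 k)) (by simpa using hz) hy
    obtain ⟨h, hh⟩ := hext d π hπ g
    have hzy : h z = y := by rw [← hg, ← hh]; rfl
    rw [← hzy, LinearMap.pi_apply_eq_sum_univ h z]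
    exact sum_mem fun k _ ↦ Submodule.smul_mem_smul (hker z hzπ k) trivial
  have hinj : Function.Injective (i.lTensor (ResidueField R)) := by
    rw [injective_iff_map_eq_zero]
    intro t ht
    obtain ⟨y, rfl⟩ := TensorProduct.mk_surjective R M (ResidueField R) residue_surjective t
    have hcoord (k) : (Module.Free.chooseBasis R N).repr (i y) k ∈ maximalIdeal R := by
      have := congrArg ((TensorProduct.rid R (ResidueField R)).toLinearMap ∘ₗ
        ((Module.Free.chooseBasis R N).coord k).lTensor (ResidueField R)) ht
      rw [← residue_eq_zero_iff]
      simpa [Algebra.smul_def] using this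
    have hy : y ∈ maximalIdeal R • (⊤ : Submodule R M) := hsoc y fun a ha ↦ hi <| by
      rw [map_smul, map_zero]
      apply (Module.Free.chooseBasis R N).repr.injective
      ext k
      simpa using hR a ha _ (hcoord k)
    refine Submodule.smul_induction_on hy (fun a ha x _ ↦ ?_) fun x x' hx hx' ↦ ?_
    · rw [map_smul, TensorProduct.mk_apply, TensorProduct.smul_tmul', Algebra.smul_def, mul_one,
        ResidueField.algebraMap_eq, (residue_eq_zero_iff a).2 ha, TensorProduct.zero_tmul]
    · rw [map_add, hx, hx', add_zero]
  obtain ⟨l, hl⟩ := (split_injective_iff_lTensor_residueField_injective i).2 hinj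
  exact .of_split i l hl

end Local

/-- If the Jacobson radical of an Artinian ring squares to zero, so do the maximal ideals of its
localizations at primes. -/
theorem IsArtinianRing.mul_eq_zero_of_mem_maximalIdeal_localization {R : Type*} [CommRing R]
    [IsArtinianRing R]
    (hJ : ∀ a ∈ (⊥ : Ideal R).jacobson, ∀ b ∈ (⊥ : Ideal R).jacobson, a * b = 0)
    (p : Ideal R) [p.IsPrime] :
    ∀ a ∈ IsLocalRing.maximalIdeal (Localization.AtPrime p),
      ∀ b ∈ IsLocalRing.maximalIdeal (Localization.AtPrime p), a * b = 0 := by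
  have key (a) (ha : a ∈ IsLocalRing.maximalIdeal (Localization.AtPrime p)) :
      ∃ x ∈ (⊥ : Ideal R).jacobson, ∃ s : p.primeCompl, a = Localization.mk x s := by
    obtain ⟨n, hn⟩ : IsNilpotent a := by
      rwa [← mem_nilradical, ← Ring.jacobson_eq_nilradical_of_krullDimLE_zero,
        ← Ideal.jacobson_bot, IsLocalRing.jacobson_eq_maximalIdeal _ bot_ne_top]
    induction a using Localization.induction_on with
    | H q =>
      obtain ⟨x, s⟩ := q
      rw [Localization.mk_pow, Localization.mk_eq_mk', IsLocalization.mk'_eq_zero_iff] at hn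
      obtain ⟨t, ht⟩ := hn
      refine ⟨t * x, ?_, t * s, ?_⟩
      · rw [Ideal.jacobson_bot, Ring.jacobson_eq_nilradical_of_krullDimLE_zero, mem_nilradical]
        refine ⟨n + 1, ?_⟩
        linear_combination (t : R) ^ n * x * ht
      · rw [Localization.mk_eq_mk_iff, Localization.r_iff_exists]
        exact ⟨1, by simp; ring⟩
  intro a ha b hb
  obtain ⟨x, hx, s, rfl⟩ := key a ha
  obtain ⟨y, hy, t, rfl⟩ := key b hb
  rw [Localization.mk_mul, hJ x hx y hy, Localization.mk_zero]

theorem stmt8 (Λ : Type u) [CommRing Λ] [IsArtinianRing Λ]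
    (hJ : ∀ a ∈ (⊥ : Ideal Λ).jacobson, ∀ b ∈ (⊥ : Ideal Λ).jacobson, a * b = 0)
    (M : Type u) [AddCommGroup M] [Module Λ M] [Module.Finite Λ M]
    (htl : IsTorsionless Λ M)
    (hext : Subsingleton (ExtGrp Λ (ModuleCat.of Λ M) (ModuleCat.of Λ M) 1)) :
    Module.Projective Λ M := by
  obtain ⟨n, i, hi⟩ := htl
  obtain ⟨d, π, hπ⟩ := Module.Finite.exists_fin' Λ M
  have hcover (g : LinearMap.ker π →ₗ[Λ] M) :
      ∃ h : (Fin d → Λ) →ₗ[Λ] M, h ∘ₗ (LinearMap.ker π).subtype = g := by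
    let P := projectiveResolution (ModuleCat.of Λ M)
    let ε : P.complex.X 0 →ₗ[Λ] M := (P.π.f 0).hom
    have hε : Function.Surjective ε := (ModuleCat.epi_iff_surjective (P.π.f 0)).1 inferInstance
    have : Module.Projective Λ (P.complex.X 0) :=
      (IsProjective.iff_projective _).2 (P.projective 0)
    have hexact := ShortComplex.moduleCat_exact_iff _ |>.1 P.exact₀
    have hzero x : ε ((P.complex.d 1 0).hom x) = 0 :=
      LinearMap.congr_fun (congrArg ModuleCat.Hom.hom P.complex_d_comp_π_f_zero) x
    let δ : P.complex.X 1 →ₗ[Λ] LinearMap.ker ε := (P.complex.d 1 0).hom.codRestrict _ hzero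
    refine exists_extension_ker_of_exact (j := (LinearMap.ker ε).subtype) hε
      (LinearMap.exact_subtype_ker_map ε) (fun g ↦ ?_) hπ g
    obtain ⟨h, hh⟩ := exists_extension_of_subsingleton_ext _ _ hext P
        (ModuleCat.ofHom (g ∘ₗ δ)) <| by
      ext x
      have hd : δ ((P.complex.d 2 1).hom x) = 0 := Subtype.ext <|
        LinearMap.congr_fun (congrArg ModuleCat.Hom.hom (P.complex.d_comp_d 2 1 0)) x
      exact (congrArg g hd).trans (map_zero g)
    refine ⟨h.hom, LinearMap.ext fun k ↦ ?_⟩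
    obtain ⟨x, hx⟩ := hexact k.1 k.2
    have hδ : δ x = k := Subtype.ext hx
    rw [← hδ]
    exact LinearMap.congr_fun (congrArg ModuleCat.Hom.hom hh) x
  have : Module.FinitePresentation Λ M := Module.finitePresentation_of_finite Λ M
  have : Module.FinitePresentation Λ (LinearMap.ker π) := Module.finitePresentation_of_finite Λ _
  refine Module.projective_of_localization_maximal fun p hp ↦ ?_
  have : Module.Free (Localization.AtPrime p) (LocalizedModule p.primeCompl (Fin n → Λ)) :=
    Module.free_of_isLocalizedModule p.primeCompl
      (LocalizedModule.mkLinearMap p.primeCompl (Fin n → Λ))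
  refine IsLocalRing.projective_of_exists_extension
    (IsArtinianRing.mul_eq_zero_of_mem_maximalIdeal_localization hJ p)
    (LocalizedModule.map p.primeCompl i) (LocalizedModule.map_injective _ i hi)
    fun e ρ hρ g ↦ ?_
  exact exists_extension_ker_of_exact (LocalizedModule.map_surjective p.primeCompl π hπ)
    (LocalizedModule.map_exact p.primeCompl _ π (LinearMap.exact_subtype_ker_map π))
    (exists_extension_localizedModule p.primeCompl hcover) hρ g
end

section
/- Let Λ be a commutative Noetherian ring and M, N finitely generated Λ-modules. Then the natural map ζ : M ⊗_Λ N → Hom_Λ(M*, N), defined by ζ(m ⊗ n)(g) = g(m)·n, fits into an exact sequence 0 → Ext¹_Λ(Tr M, N) → M ⊗_Λ N → Hom_Λ(M*, N) → Ext²_Λ(Tr M, N) → 0. -/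
open CategoryTheory TensorProduct

universe u

variable (Λ : Type u) [CommRing Λ]

/-- The natural map `ζ : M ⊗ N → Hom(M*, N)`, `ζ(m ⊗ n)(g) = g(m) • n`. -/
noncomputable def zetaMap (M N : Type u) [AddCommGroup M] [Module Λ M]
    [AddCommGroup N] [Module Λ N] :
    (M ⊗[Λ] N) →ₗ[Λ] (Module.Dual Λ M →ₗ[Λ] N) :=
  TensorProduct.lift (LinearMap.mk₂ Λ
    (fun m n => (Module.Dual.eval Λ M m).smulRight n)
    (fun m m' n => by ext g; simp [add_smul])
    (fun c m n => by ext g; simp [mul_smul])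
    (fun m n n' => by ext g; simp [smul_add])
    (fun c m n => by
      ext g
      simp only [LinearMap.smulRight_apply, LinearMap.smul_apply]
      exact smul_comm _ c n))

/-- The transpose of `M` with respect to the finite free presentation `f`. -/
abbrev TransposeOf (p q : ℕ) (f : (Fin p → Λ) →ₗ[Λ] (Fin q → Λ)) : Type u :=
  (Module.Dual Λ (Fin p → Λ)) ⧸ LinearMap.range f.dualMap

section Resolution

open Limits

variable {C : Type*} [Category* C] [Abelian C] [EnoughProjectives C]
  {A₁ A₀ X : C}

lemma projective_d_comp {A B : C} (f : A ⟶ B) : Projective.d f ≫ f = 0 :=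
  (Category.assoc _ _ _).trans
    ((congrArg (Projective.π _ ≫ ·) (kernel.condition f)).trans comp_zero)

/-- The chain complex extending `d` to the left by projectives mapping onto successive kernels. -/
noncomputable def resolutionComplex (d : A₁ ⟶ A₀) : ChainComplex C ℕ :=
  ChainComplex.mk' A₀ A₁ d (fun f => ⟨_, Projective.d f, projective_d_comp f⟩)

lemma resolutionComplex_d (d : A₁ ⟶ A₀) : (resolutionComplex d).d 1 0 = d :=
  ChainComplex.mk'_d_1_0 _ _ _ _

/-- The objects of `resolutionComplex d` in degrees at least two are syzygies. -/
noncomputable def resolutionComplexXIso (d : A₁ ⟶ A₀) (n : ℕ) :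
    (resolutionComplex d).X (n + 2) ≅ Projective.syzygies ((resolutionComplex d).d (n + 1) n) :=
  ChainComplex.mk'XIso _ _ _ _ n

lemma resolutionComplex_d_succ (d : A₁ ⟶ A₀) (n : ℕ) :
    (resolutionComplex d).d (n + 2) (n + 1) = (resolutionComplexXIso d n).hom ≫
      Projective.d ((resolutionComplex d).d (n + 1) n) :=
  ChainComplex.mk'_d _ _ _ _ n

lemma resolutionComplex_exactAt_succ (d : A₁ ⟶ A₀) (n : ℕ) :
    (resolutionComplex d).ExactAt (n + 1) := by
  rw [HomologicalComplex.exactAt_iff' _ (n + 1 + 1) (n + 1) n (by simp) (by simp)]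
  refine (ShortComplex.exact_iff_of_iso ?_).2 (exact_d_f ((resolutionComplex d).d (n + 1) n))
  refine ShortComplex.isoMk (resolutionComplexXIso d n) (Iso.refl _) (Iso.refl _) ?_ ?_
  · exact ((Category.comp_id _).trans (resolutionComplex_d_succ d n)).symm
  · exact (Category.id_comp _).trans (Category.comp_id _).symm

instance (d : A₁ ⟶ A₀) [h0 : Projective A₀] [h1 : Projective A₁] (n : ℕ) :
    Projective ((resolutionComplex d).X n) := by
  obtain (_ | _ | n) := n
  · exact h0
  · exact h1
  · exact Projective.of_iso (resolutionComplexXIso d n).symm (Projective.projective_over _)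

/-- The projective resolution extending a projective presentation `A₁ ⟶ A₀ ⟶ X ⟶ 0`. -/
noncomputable def resolutionOfExact (d : A₁ ⟶ A₀) (ε : A₀ ⟶ X) (w : d ≫ ε = 0)
    [Projective A₀] [Projective A₁] [Epi ε] (hex : (ShortComplex.mk d ε w).Exact) :
    ProjectiveResolution X where
  complex := resolutionComplex d
  π := (ChainComplex.toSingle₀Equiv _ _).symm ⟨ε, by
          rw [resolutionComplex_d]; exact w⟩
  quasiIso := ⟨fun n => by
    cases n
    · rw [ChainComplex.quasiIsoAt₀_iff, ShortComplex.quasiIso_iff_of_zeros']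
      · refine (ShortComplex.exact_and_epi_g_iff_of_iso ?_).2
          ⟨hex, by dsimp; infer_instance⟩
        refine ShortComplex.isoMk (Iso.refl _) (Iso.refl _) (Iso.refl _) ?_ ?_
        · exact (Category.id_comp _).trans ((Category.comp_id _).trans (resolutionComplex_d d)).symm
        · exact (Category.id_comp _).trans (Eq.trans (ChainComplex.toSingle₀Equiv_symm_apply_f_zero
            (C := resolutionComplex d) (X := X) ε _).symm (Category.comp_id _).symm)
      all_goals rfl
    · rw [quasiIsoAt_iff_exactAt']
      · apply resolutionComplex_exactAt_succ
      · apply ChainComplex.exactAt_succ_single_obj⟩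

lemma exists_homology_presentation {R : Type*} [Ring R]
    (S : ShortComplex (ModuleCat.{u} R)) :
    ∃ φ : LinearMap.ker S.g.hom →ₗ[R] S.homology, Function.Surjective φ ∧
      ∀ h, φ h = 0 ↔ (h : S.X₂) ∈ LinearMap.range S.f.hom := by
  let e : (LinearMap.ker S.g.hom ⧸ LinearMap.range S.moduleCatToCycles) ≃ₗ[R] S.homology :=
    S.moduleCatHomologyIso.toLinearEquiv.symm
  refine ⟨e.toLinearMap ∘ₗ (LinearMap.range S.moduleCatToCycles).mkQ, ?_, fun h ↦ ?_⟩
  · exact e.surjective.comp (Submodule.mkQ_surjective _)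
  · rw [LinearMap.comp_apply, LinearEquiv.coe_coe, LinearEquiv.map_eq_zero_iff,
      Submodule.mkQ_apply, Submodule.Quotient.mk_eq_zero]
    constructor
    · rintro ⟨y, hy⟩; exact ⟨y, congrArg Subtype.val hy⟩
    · rintro ⟨y, hy⟩; exact ⟨y, Subtype.ext hy⟩

lemma exists_ext_presentation {C : Type*} [Category* C] [Abelian C] [EnoughProjectives C]
    {X : C} (P : ProjectiveResolution X) (Y : C) (n : ℕ) :
    ∃ φ : (Preadditive.leftComp Y (P.complex.d (n + 2) (n + 1))).ker →+
        ((Ext ℤ C (n + 1)).obj (Opposite.op X)).obj Y,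
      Function.Surjective φ ∧
        ∀ h, φ h = 0 ↔ ∃ k : P.complex.X n ⟶ Y, P.complex.d (n + 1) n ≫ k = h.1 := by
  obtain ⟨φ, hφ, hφ'⟩ := exists_homology_presentation
    ((P.complex.linearYonedaObj ℤ Y).sc' n (n + 1) (n + 2))
  let e := (P.isoExt (R := ℤ) (n + 1) Y ≪≫
    (P.complex.linearYonedaObj ℤ Y).homologyIsoSc' n (n + 1) (n + 2)
      (by simp) (by simp)).toLinearEquiv
  refine ⟨(e.symm.toLinearMap ∘ₗ φ).toAddMonoidHom, e.symm.surjective.comp hφ, fun h ↦ ?_⟩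
  exact e.symm.map_eq_zero_iff.trans (hφ' h)

end Resolution

variable {Λ}

theorem zetaMap_tmul_apply {M N : Type u} [AddCommGroup M] [Module Λ M]
    [AddCommGroup N] [Module Λ N] (m : M) (n : N) (g : Module.Dual Λ M) :
    zetaMap Λ M N (m ⊗ₜ n) g = g m • n :=
  rfl

theorem zetaMap_rTensor {M M' N : Type u} [AddCommGroup M] [Module Λ M]
    [AddCommGroup M'] [Module Λ M'] [AddCommGroup N] [Module Λ N] (g : M →ₗ[Λ] M') (x : M ⊗[Λ] N) :
    zetaMap Λ M' N (g.rTensor N x) = zetaMap Λ M N x ∘ₗ g.dualMap := by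
  induction x with
  | zero => simp
  | add x y hx hy => simp only [map_add, hx, hy, LinearMap.add_comp]
  | tmul m n => rfl

theorem zetaMap_bijective (M N : Type u) [AddCommGroup M] [Module Λ M]
    [AddCommGroup N] [Module Λ N] [Module.Finite Λ M] [Module.Free Λ M] :
    Function.Bijective (zetaMap Λ M N) := by
  let e : (M ⊗[Λ] N) ≃ₗ[Λ] (Module.Dual Λ M →ₗ[Λ] N) :=
    TensorProduct.congr (Module.evalEquiv Λ M) (LinearEquiv.refl Λ N) ≪≫ₗ
      dualTensorHomEquiv Λ (Module.Dual Λ M) N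
  have : zetaMap Λ M N = e.toLinearMap := by
    ext m n g
    simp [e, zetaMap_tmul_apply]
  rw [this]
  exact e.bijective

theorem ker_dualMap_of_exact {P Q M : Type u} [AddCommGroup P] [Module Λ P]
    [AddCommGroup Q] [Module Λ Q] [AddCommGroup M] [Module Λ M]
    (f : P →ₗ[Λ] Q) (g : Q →ₗ[Λ] M) (hg : Function.Surjective g)
    (hexact : LinearMap.range f = LinearMap.ker g) :
    LinearMap.ker f.dualMap = LinearMap.range g.dualMap := by
  rw [LinearMap.ker_dualMap_eq_dualAnnihilator_range, hexact,
    LinearMap.range_dualMap_eq_dualAnnihilator_ker_of_surjective _ hg]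


theorem exists_ext_one_presentation_of_resolution {X : ModuleCat.{u} Λ} (P : ProjectiveResolution X)
    (Y : ModuleCat.{u} Λ) (d : P.complex.X 1 ⟶ P.complex.X 0) (hd : P.complex.d 1 0 = d) :
    ∃ φ : LinearMap.ker (LinearMap.lcomp Λ Y (LinearMap.ker d.hom).subtype) →+ ExtGrp Λ X Y 1,
      Function.Surjective φ ∧
        ∀ h, φ h = 0 ↔ (h : P.complex.X 1 →ₗ[Λ] Y) ∈ LinearMap.range (LinearMap.lcomp Λ Y d.hom) := by
  subst hd
  obtain ⟨φ, hφ, hφ'⟩ := exists_ext_presentation P Y 0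
  have hr := (P.exact_succ 0).moduleCat_range_eq_ker
  have hiff (h : P.complex.X 1 →ₗ[Λ] Y) :
      h ∈ LinearMap.ker (LinearMap.lcomp Λ Y (LinearMap.ker (P.complex.d 1 0).hom).subtype) ↔
        ModuleCat.ofHom h ∈ (Preadditive.leftComp Y (P.complex.d 2 1)).ker := by
    rw [LinearMap.mem_ker, AddMonoidHom.mem_ker]
    constructor
    · intro H
      ext x
      exact LinearMap.congr_fun H ⟨(P.complex.d 2 1).hom x, hr.le ⟨x, rfl⟩⟩
    · intro H
      ext ⟨x, hx⟩
      obtain ⟨y, rfl⟩ := hr.ge hx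
      exact LinearMap.congr_fun (congrArg ModuleCat.Hom.hom H) y
  let j : LinearMap.ker (LinearMap.lcomp Λ Y (LinearMap.ker (P.complex.d 1 0).hom).subtype) →+
      (Preadditive.leftComp Y (P.complex.d 2 1)).ker :=
    { toFun h := ⟨ModuleCat.ofHom h.1, (hiff h.1).1 h.2⟩
      map_zero' := rfl
      map_add' _ _ := rfl }
  refine ⟨φ.comp j, hφ.comp fun h ↦ ⟨⟨h.1.hom, (hiff _).2 h.2⟩, rfl⟩, fun h ↦ (hφ' (j h)).trans ?_⟩
  constructor
  · rintro ⟨k, hk⟩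
    exact ⟨k.hom, congrArg ModuleCat.Hom.hom hk⟩
  · rintro ⟨k, hk⟩
    exact ⟨ModuleCat.ofHom k, ModuleCat.hom_ext hk⟩

theorem exists_ext_two_presentation_of_resolution {X : ModuleCat.{u} Λ} (P : ProjectiveResolution X)
    (Y : ModuleCat.{u} Λ) (d : P.complex.X 1 ⟶ P.complex.X 0) (hd : P.complex.d 1 0 = d) :
    ∃ φ : (LinearMap.ker d.hom →ₗ[Λ] Y) →+ ExtGrp Λ X Y 2,
      Function.Surjective φ ∧
        ∀ h, φ h = 0 ↔ h ∈ LinearMap.range (LinearMap.lcomp Λ Y (LinearMap.ker d.hom).subtype) := by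
  subst hd
  obtain ⟨φ, hφ, hφ'⟩ := exists_ext_presentation P Y 1
  have hr₁ := (P.exact_succ 0).moduleCat_range_eq_ker
  have hr₂ := (P.exact_succ 1).moduleCat_range_eq_ker
  let p : P.complex.X 2 →ₗ[Λ] LinearMap.ker (P.complex.d 1 0).hom :=
    (P.complex.d 2 1).hom.codRestrict _ fun x ↦ hr₁.le ⟨x, rfl⟩
  have hp : Function.Surjective p := fun ⟨x, hx⟩ ↦
    (hr₁.ge hx).imp fun y hy ↦ Subtype.ext hy
  have hpd (x : P.complex.X 3) : p ((P.complex.d 3 2).hom x) = 0 :=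
    Subtype.ext (hr₂.le ⟨x, rfl⟩)
  have hker : LinearMap.ker p = LinearMap.range (P.complex.d 3 2).hom := by
    rw [LinearMap.ker_codRestrict]
    exact hr₂.symm
  let j : (LinearMap.ker (P.complex.d 1 0).hom →ₗ[Λ] Y) →+
      (Preadditive.leftComp Y (P.complex.d 3 2)).ker :=
    { toFun h := ⟨ModuleCat.ofHom (h ∘ₗ p), by
        rw [AddMonoidHom.mem_ker]
        ext x
        exact (congrArg h (hpd x)).trans (map_zero h)⟩
      map_zero' := rfl
      map_add' _ _ := rfl }
  have hj : Function.Surjective j := by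
    rintro ⟨h, hh⟩
    have hle : LinearMap.ker p ≤ LinearMap.ker h.hom := by
      rw [hker]
      rintro _ ⟨x, rfl⟩
      exact LinearMap.congr_fun (congrArg ModuleCat.Hom.hom hh) x
    refine ⟨(LinearMap.ker p).liftQ h.hom hle ∘ₗ (p.quotKerEquivOfSurjective hp).symm.toLinearMap,
      Subtype.ext (ModuleCat.hom_ext (LinearMap.ext fun x ↦ ?_))⟩
    change (LinearMap.ker p).liftQ h.hom hle ((p.quotKerEquivOfSurjective hp).symm (p x)) = h.hom x
    rw [(LinearEquiv.symm_apply_eq _).2 (p.quotKerEquivOfSurjective_apply_mk hp x).symm,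
      Submodule.liftQ_apply]
  refine ⟨φ.comp j, hφ.comp hj, fun h ↦ (hφ' (j h)).trans ?_⟩
  constructor
  · rintro ⟨k, hk⟩
    refine ⟨k.hom, LinearMap.ext fun x ↦ ?_⟩
    obtain ⟨y, rfl⟩ := hp x
    exact LinearMap.congr_fun (congrArg ModuleCat.Hom.hom hk) y
  · rintro ⟨k, rfl⟩
    exact ⟨ModuleCat.ofHom k, rfl⟩

section

variable {A₁ A₀ X : Type u} [AddCommGroup A₁] [Module Λ A₁] [AddCommGroup A₀] [Module Λ A₀]
  [AddCommGroup X] [Module Λ X] [Module.Projective Λ A₁] [Module.Projective Λ A₀]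

theorem exists_ext_one_presentation (d : A₁ →ₗ[Λ] A₀) (ε : A₀ →ₗ[Λ] X)
    (hε : Function.Surjective ε) (h : LinearMap.range d = LinearMap.ker ε)
    (N : Type u) [AddCommGroup N] [Module Λ N] :
    ∃ φ : LinearMap.ker (LinearMap.lcomp Λ N (LinearMap.ker d).subtype) →+
        ExtGrp Λ (ModuleCat.of Λ X) (ModuleCat.of Λ N) 1,
      Function.Surjective φ ∧
        ∀ h, φ h = 0 ↔ (h : A₁ →ₗ[Λ] N) ∈ LinearMap.range (LinearMap.lcomp Λ N d) := by
  have := ModuleCat.projective_of_categoryTheory_projective (ModuleCat.of Λ A₁)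
  have := ModuleCat.projective_of_categoryTheory_projective (ModuleCat.of Λ A₀)
  have : Epi (ModuleCat.ofHom ε) := (ModuleCat.epi_iff_surjective _).2 hε
  exact exists_ext_one_presentation_of_resolution
    (resolutionOfExact _ (ModuleCat.ofHom ε)
    (ModuleCat.hom_ext (LinearMap.range_le_ker_iff.1 h.le))
    ((ShortComplex.moduleCat_exact_iff_range_eq_ker _).2 h)) (ModuleCat.of Λ N) (ModuleCat.ofHom d)
      (resolutionComplex_d _)

theorem exists_ext_two_presentation (d : A₁ →ₗ[Λ] A₀) (ε : A₀ →ₗ[Λ] X)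
    (hε : Function.Surjective ε) (h : LinearMap.range d = LinearMap.ker ε)
    (N : Type u) [AddCommGroup N] [Module Λ N] :
    ∃ φ : (LinearMap.ker d →ₗ[Λ] N) →+ ExtGrp Λ (ModuleCat.of Λ X) (ModuleCat.of Λ N) 2,
      Function.Surjective φ ∧
        ∀ h, φ h = 0 ↔ h ∈ LinearMap.range (LinearMap.lcomp Λ N (LinearMap.ker d).subtype) := by
  have := ModuleCat.projective_of_categoryTheory_projective (ModuleCat.of Λ A₁)
  have := ModuleCat.projective_of_categoryTheory_projective (ModuleCat.of Λ A₀)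
  have : Epi (ModuleCat.ofHom ε) := (ModuleCat.epi_iff_surjective _).2 hε
  exact exists_ext_two_presentation_of_resolution
    (resolutionOfExact _ (ModuleCat.ofHom ε)
    (ModuleCat.hom_ext (LinearMap.range_le_ker_iff.1 h.le))
    ((ShortComplex.moduleCat_exact_iff_range_eq_ker _).2 h)) (ModuleCat.of Λ N) (ModuleCat.ofHom d)
      (resolutionComplex_d _)

end

variable (Λ)

theorem stmt9 [IsNoetherianRing Λ]
    (M N : Type u) [AddCommGroup M] [Module Λ M] [AddCommGroup N] [Module Λ N]
    [Module.Finite Λ M] [Module.Finite Λ N]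
    (p q : ℕ) (f : (Fin p → Λ) →ₗ[Λ] (Fin q → Λ)) (g : (Fin q → Λ) →ₗ[Λ] M)
    (hg : Function.Surjective g) (hexact : LinearMap.range f = LinearMap.ker g) :
    ∃ (ι : ExtGrp Λ (ModuleCat.of Λ (TransposeOf Λ p q f)) (ModuleCat.of Λ N) 1 →+
          (M ⊗[Λ] N))
      (π : (Module.Dual Λ M →ₗ[Λ] N) →+
          ExtGrp Λ (ModuleCat.of Λ (TransposeOf Λ p q f)) (ModuleCat.of Λ N) 2),
      Function.Injective ι ∧
      (∀ x : M ⊗[Λ] N, x ∈ Set.range ι ↔ zetaMap Λ M N x = 0) ∧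
      Function.Surjective π ∧
      (∀ h : Module.Dual Λ M →ₗ[Λ] N, π h = 0 ↔ h ∈ Set.range (zetaMap Λ M N)) := by
  have hε := Submodule.mkQ_surjective (LinearMap.range f.dualMap)
  have hd := (Submodule.ker_mkQ (LinearMap.range f.dualMap)).symm
  obtain ⟨φ, hφ, hφ_iff⟩ := exists_ext_one_presentation f.dualMap _ hε hd N
  obtain ⟨ψ, hψ, hψ_iff⟩ := exists_ext_two_presentation f.dualMap _ hε hd N
  have hker : LinearMap.ker f.dualMap = LinearMap.range g.dualMap :=
    ker_dualMap_of_exact f g hg hexact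
  have hginj : Function.Injective g.dualMap := LinearMap.dualMap_injective_of_surjective hg
  have hgN : Function.Surjective (g.rTensor N) := LinearMap.rTensor_surjective N hg
  have hfgN : Function.Exact (f.rTensor N) (g.rTensor N) :=
    rTensor_exact N (LinearMap.exact_iff.2 hexact.symm) hg
  let αp := LinearEquiv.ofBijective _ (zetaMap_bijective (Λ := Λ) (Fin p → Λ) N)
  let α := LinearEquiv.ofBijective _ (zetaMap_bijective (Λ := Λ) (Fin q → Λ) N)
  have hζ (k : Module.Dual Λ (Fin q → Λ) →ₗ[Λ] N) :
      zetaMap Λ M N (g.rTensor N (α.symm k)) = k ∘ₗ g.dualMap := by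
    rw [zetaMap_rTensor]
    exact congrArg (· ∘ₗ g.dualMap) (α.apply_symm_apply k)
  let θ : LinearMap.ker (LinearMap.lcomp Λ N (LinearMap.ker f.dualMap).subtype) →+ M ⊗[Λ] N :=
    (g.rTensor N ∘ₗ α.symm.toLinearMap ∘ₗ Submodule.subtype _).toAddMonoidHom
  have hθφ (h) : θ h = 0 ↔ φ h = 0 := by
    rw [hφ_iff]
    refine (hfgN (α.symm h.1)).trans ?_
    constructor
    · rintro ⟨y, hy⟩
      refine ⟨αp y, ?_⟩
      exact (zetaMap_rTensor f y).symm.trans ((LinearEquiv.eq_symm_apply α).1 hy)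
    · rintro ⟨k, hk⟩
      refine ⟨αp.symm k, ?_⟩
      rw [LinearEquiv.eq_symm_apply, ← hk]
      refine (zetaMap_rTensor f _).trans ?_
      exact congrArg (· ∘ₗ f.dualMap) (αp.apply_symm_apply k)
  let ι := AddMonoidHom.liftOfSurjective φ hφ ⟨θ, fun h hh ↦ (hθφ h).2 hh⟩
  have hι (h) : ι (φ h) = θ h := AddMonoidHom.liftOfRightInverse_comp_apply _ _ _ _ h
  let e : Module.Dual Λ M ≃ₗ[Λ] LinearMap.ker f.dualMap :=
    LinearEquiv.ofInjective g.dualMap hginj ≪≫ₗ LinearEquiv.ofEq _ _ hker.symm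
  have he (y) : (e y : Module.Dual Λ (Fin q → Λ)) = g.dualMap y := rfl
  let c : (Module.Dual Λ M →ₗ[Λ] N) ≃ₗ[Λ] (LinearMap.ker f.dualMap →ₗ[Λ] N) :=
    e.arrowCongr (LinearEquiv.refl Λ N)
  refine ⟨ι, ψ.comp c.toLinearMap.toAddMonoidHom, ?_, fun x ↦ ?_, hψ.comp c.surjective,
    fun h ↦ (hψ_iff (c h)).trans ?_⟩
  · rw [injective_iff_map_eq_zero]
    intro x hx
    obtain ⟨h, rfl⟩ := hφ x
    rwa [hι, hθφ] at hx
  · constructor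
    · rintro ⟨y, rfl⟩
      obtain ⟨h, rfl⟩ := hφ y
      rw [hι]
      refine (hζ h.1).trans (LinearMap.ext fun y ↦ ?_)
      exact LinearMap.congr_fun h.2 (e y)
    · intro hx
      obtain ⟨t, rfl⟩ := hgN x
      rw [← α.symm_apply_apply t, hζ] at hx
      refine ⟨φ ⟨α t, LinearMap.ext fun y ↦ ?_⟩, ?_⟩
      · obtain ⟨z, rfl⟩ := e.surjective y
        exact LinearMap.congr_fun hx z
      · rw [hι]
        exact congrArg (g.rTensor N) (α.symm_apply_apply t)
  · constructor
    · rintro ⟨k, hk⟩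
      refine ⟨g.rTensor N (α.symm k), (hζ k).trans (LinearMap.ext fun y ↦ ?_)⟩
      have := LinearMap.congr_fun hk (e y)
      simpa [c, he] using this
    · rintro ⟨x, rfl⟩
      obtain ⟨t, rfl⟩ := hgN x
      refine ⟨α t, LinearMap.ext fun y ↦ ?_⟩
      obtain ⟨z, rfl⟩ := e.surjective y
      simp [c, zetaMap_rTensor, he, α]
end

section
/- Let Λ be a local Artinian ring with residue field k and M a finitely generated torsionless Λ-module with Ext¹_Λ(M,M) = 0 such that Ext¹_Λ(k, M) = 0. Then M is projective. -/
open CategoryTheory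

universe u

/-- A `1`-cocycle on a projective resolution is a coboundary as soon as `Ext¹` vanishes. -/
theorem exists_d_comp_eq_of_subsingleton_extGrp {Λ : Type u} [Ring Λ] {X Y : ModuleCat.{u} Λ}
    (P : ProjectiveResolution X) (h : Subsingleton (ExtGrp Λ X Y 1))
    (f : P.complex.X 1 ⟶ Y) (hf : P.complex.d 2 1 ≫ f = 0) :
    ∃ g : P.complex.X 0 ⟶ Y, P.complex.d 1 0 ≫ g = f := by
  have hz : Limits.IsZero ((P.complex.linearYonedaObj ℤ Y).homology 1) :=
    (ModuleCat.isZero_of_subsingleton _).of_iso (P.isoExt (R := ℤ) 1 Y).symm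
  rw [← HomologicalComplex.exactAt_iff_isZero_homology,
    HomologicalComplex.exactAt_iff' _ 0 1 2 (by simp) (by simp),
    ShortComplex.moduleCat_exact_iff] at hz
  exact hz f hf

/-- If `Ext¹_Λ(Λ ⧸ I, M) = 0`, then every linear map `I → M` is multiplication by an element
of `M`. -/
theorem exists_smul_eq_of_subsingleton_extGrp_quotient {Λ : Type u} [CommRing Λ] {I : Ideal Λ}
    {M : Type u} [AddCommGroup M] [Module Λ M]
    (h : Subsingleton (ExtGrp Λ (ModuleCat.of Λ (Λ ⧸ I)) (ModuleCat.of Λ M) 1)) (φ : I →ₗ[Λ] M) :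
    ∃ y : M, ∀ a : I, φ a = (a : Λ) • y := by
  let P := ProjectiveResolution.of (ModuleCat.of Λ (Λ ⧸ I))
  let π : P.complex.X 0 →ₗ[Λ] Λ ⧸ I := (P.π.f 0).hom
  have hπ : Function.Surjective π := (ModuleCat.epi_iff_surjective (P.π.f 0)).1 inferInstance
  let d : P.complex.X 1 →ₗ[Λ] P.complex.X 0 := (P.complex.d 1 0).hom
  have hdπ : ∀ q, π (d q) = 0 := fun q =>
    congrArg (fun t => t.hom q) P.complex_d_comp_π_f_zero
  have hd : ∀ p, π p = 0 → ∃ q, d q = p :=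
    (ShortComplex.moduleCat_exact_iff _).1 P.exact₀
  have : Module.Projective Λ (P.complex.X 0) :=
    (IsProjective.iff_projective (R := Λ) (P.complex.X 0)).2 (P.projective 0)
  obtain ⟨α, hα⟩ := Module.projective_lifting_property I.mkQ π I.mkQ_surjective
  have hα' : ∀ p, I.mkQ (α p) = π p := fun p => congrArg (fun t => t p) hα
  let β : P.complex.X 1 →ₗ[Λ] I := (α ∘ₗ d).codRestrict I fun q => by
    rw [← Submodule.Quotient.mk_eq_zero]
    exact (hα' _).trans (hdπ q)
  obtain ⟨ψ, hψ⟩ := exists_d_comp_eq_of_subsingleton_extGrp P h (ModuleCat.ofHom (φ ∘ₗ β)) (by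
    ext q
    have hq : d ((P.complex.d 2 1).hom q) = 0 :=
      congrArg (fun t => t.hom q) (P.complex.d_comp_d 2 1 0)
    have hβ : β ((P.complex.d 2 1).hom q) = 0 := Subtype.ext (by simp [β, hq])
    change φ (β ((P.complex.d 2 1).hom q)) = 0
    rw [hβ, map_zero])
  have hψ' : ∀ q, ψ.hom (d q) = φ (β q) := fun q => congrArg (fun t => t.hom q) hψ
  obtain ⟨p, hp⟩ := hπ (I.mkQ 1)
  have hu : 1 - α p ∈ I := by
    rw [← Submodule.Quotient.mk_eq_zero]
    change I.mkQ (1 - α p) = 0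
    rw [map_sub, hα', hp, sub_self]
  refine ⟨ψ.hom p + φ ⟨1 - α p, hu⟩, fun a => ?_⟩
  obtain ⟨q, hq⟩ := hd ((a : Λ) • p) (by
    rw [map_smul, hp, ← map_smul, smul_eq_mul, mul_one]
    exact (Submodule.Quotient.mk_eq_zero _).2 a.2)
  have hψp : (a : Λ) • ψ.hom p = φ (β q) := by rw [← hψ', hq, map_smul]
  rw [smul_add, hψp, ← map_smul, ← map_add]
  congr 1
  ext
  simp [β, hq]
  ring

/-- Over a local Artinian ring, every proper ideal `J` has an element outside `J` that the maximal
ideal multiplies into `J`. -/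
theorem IsLocalRing.exists_notMem_forall_mul_mem {Λ : Type*} [CommRing Λ] [IsArtinianRing Λ]
    [IsLocalRing Λ] {J : Ideal Λ} (hJ : J ≠ ⊤) :
    ∃ x ∉ J, ∀ a ∈ IsLocalRing.maximalIdeal Λ, a * x ∈ J := by
  classical
  have hex : ∃ n, IsLocalRing.maximalIdeal Λ ^ n ≤ J := by
    obtain ⟨n, hn⟩ := IsArtinianRing.isNilpotent_jacobson_bot (R := Λ)
    rw [IsLocalRing.jacobson_eq_maximalIdeal ⊥ bot_ne_top] at hn
    exact ⟨n, hn.trans_le bot_le⟩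
  obtain ⟨n, hn⟩ : ∃ n, Nat.find hex = n + 1 := Nat.exists_eq_succ_of_ne_zero fun h0 => hJ <| by
    simpa [h0] using Nat.find_spec hex
  obtain ⟨x, hx, hxJ⟩ := SetLike.not_le_iff_exists.1 (Nat.find_min hex (m := n) (by lia))
  refine ⟨x, hxJ, fun a ha => Nat.find_spec hex ?_⟩
  rw [hn, pow_succ']
  exact Ideal.mul_mem_mul ha hx

/-- Over a local Artinian ring, a module into which every map from the maximal ideal
is a multiplication is injective. -/
theorem Module.Baer.of_forall_maximalIdeal {Λ : Type*} [CommRing Λ] [IsArtinianRing Λ]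
    [IsLocalRing Λ] {M : Type*} [AddCommGroup M] [Module Λ M]
    (h : ∀ φ : IsLocalRing.maximalIdeal Λ →ₗ[Λ] M, ∃ y : M, ∀ a, φ a = (a : Λ) • y) :
    Module.Baer Λ M := by
  intro I
  induction I using WellFoundedGT.induction with
  | ind J ih =>
    intro g
    by_cases hJ : J = ⊤
    · subst hJ
      exact ⟨g ∘ₗ Submodule.topEquiv.symm.toLinearMap, fun x hx => rfl⟩
    obtain ⟨x, hxJ, hx⟩ := IsLocalRing.exists_notMem_forall_mul_mem hJ
    obtain ⟨y, hy⟩ := h (g ∘ₗ ((LinearMap.toSpanSingleton Λ Λ x).restrict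
      fun a ha => hx a ha))
    have hy' : ∀ c (hc : c * x ∈ J), g ⟨c * x, hc⟩ = c • y := fun c hc => by
      refine hy ⟨c, fun hu => hxJ ?_⟩
      exact (Ideal.unit_mul_mem_iff_mem J hu).1 hc
    have H : ∀ c : Λ, c • x = 0 → c • y = 0 := fun c hc => by
      rw [← hy' c (by rw [← smul_eq_mul, hc]; exact J.zero_mem), ← map_zero g]
      exact congrArg g (Subtype.ext hc)
    let g₁ : Λ →ₗ.[Λ] M := ⟨J, g⟩
    let g₂ : Λ →ₗ.[Λ] M := LinearPMap.mkSpanSingleton' x y H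
    have hg : ∀ (a : g₁.domain) (b : g₂.domain), (a : Λ) = b → g₁ a = g₂ b := by
      rintro ⟨a, ha⟩ ⟨b, hb⟩ (rfl : a = b)
      obtain ⟨c, rfl⟩ := Submodule.mem_span_singleton.1 hb
      exact (hy' c ha).trans (LinearPMap.mkSpanSingleton'_apply x y H c hb).symm
    have hlt : J < (g₁.sup g₂ hg).domain :=
      lt_of_le_of_ne le_sup_left fun he => hxJ <| he ▸
        (le_sup_right : g₂.domain ≤ g₁.domain ⊔ g₂.domain) (Submodule.mem_span_singleton_self x)
    obtain ⟨g', hg'⟩ := ih _ hlt (g₁.sup g₂ hg).toFun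
    exact ⟨g', fun a ha => (hg' a (hlt.le ha)).trans
      ((LinearPMap.left_le_sup g₁ g₂ hg).2 (x := ⟨a, ha⟩) (y := ⟨a, hlt.le ha⟩) rfl).symm⟩

/-- An injective submodule of a projective module is projective. -/
theorem Module.Projective.of_injective_of_baer {Λ M P : Type*} [CommRing Λ]
    [AddCommGroup M] [Module Λ M] [AddCommGroup P] [Module Λ P] [Module.Projective Λ P]
    (hM : Module.Baer Λ M) (f : M →ₗ[Λ] P) (hf : Function.Injective f) :
    Module.Projective Λ M := by
  obtain ⟨s, hs⟩ := hM.extension_property f hf LinearMap.id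
  exact Module.Projective.of_split f s hs

theorem stmt15 (Λ : Type u) [CommRing Λ] [IsArtinianRing Λ] [IsLocalRing Λ]
    (M : Type u) [AddCommGroup M] [Module Λ M] [Module.Finite Λ M]
    (htl : IsTorsionless Λ M)
    (hMM : Subsingleton (ExtGrp Λ (ModuleCat.of Λ M) (ModuleCat.of Λ M) 1))
    (hkM : Subsingleton (ExtGrp Λ (ModuleCat.of Λ (IsLocalRing.ResidueField Λ))
      (ModuleCat.of Λ M) 1)) :
    Module.Projective Λ M := by
  obtain ⟨n, f, hf⟩ := htl
  exact .of_injective_of_baer (.of_forall_maximalIdeal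
    (exists_smul_eq_of_subsingleton_extGrp_quotient hkM)) f hf
end

section
/- Let Λ be a commutative Artinian local ring and M a finitely generated Λ-module with minimal projective presentation P₁ →f P₀ → M → 0 such that Ext^i_Λ(M, Λ) = 0 for i = 1, 2, 3. Then (Tr M)* ≅ Ker f, there is an exact sequence 0 → (Tr M)* → P₁ → P₀ → M → 0, and Ext¹_Λ((Tr M)*, Λ) = 0, i.e., (Tr M)* lies in ⊥₁Λ. -/
open CategoryTheory

universe u

namespace CategoryTheory

open Limits

variable {C : Type*} [Category* C] [Abelian C]

/-- The degree zero component of a projective resolution of `X`, as a morphism to `X` itself. -/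
noncomputable def ProjectiveResolution.augmentation {X : C} (P : ProjectiveResolution X) :
    P.complex.X 0 ⟶ X :=
  P.π.f 0

namespace ShortComplex.ShortExact

variable {S : ShortComplex C}

lemma d_comp_augmentation_comp_f (P : ProjectiveResolution S.X₁) :
    P.complex.d 1 0 ≫ P.augmentation ≫ S.f = 0 := by
  have h : P.complex.d 1 0 ≫ P.augmentation = 0 := P.complex_d_comp_π_f_zero
  rw [← Category.assoc, h, zero_comp]

lemma augmentation_comp_f_comp_g (P : ProjectiveResolution S.X₁) :
    (P.augmentation ≫ S.f) ≫ S.g = 0 := by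
  rw [Category.assoc, S.zero, comp_zero]

lemma exact_augmentation_comp_f (hS : S.ShortExact) (P : ProjectiveResolution S.X₁) :
    (ShortComplex.mk _ _ (augmentation_comp_f_comp_g P)).Exact := by
  let φ : ShortComplex.mk _ _ (augmentation_comp_f_comp_g P) ⟶ S :=
    { τ₁ := P.augmentation, τ₂ := 𝟙 _, τ₃ := 𝟙 _ }
  have : Epi φ.τ₁ := (inferInstance : Epi (P.π.f 0))
  have : IsIso φ.τ₂ := (inferInstance : IsIso (𝟙 S.X₂))
  have : Mono φ.τ₃ := (inferInstance : Mono (𝟙 S.X₃))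
  exact (ShortComplex.exact_iff_of_epi_of_isIso_of_mono φ).2 hS.exact

lemma exact_d_augmentation_comp_f (hS : S.ShortExact) (P : ProjectiveResolution S.X₁) :
    (ShortComplex.mk _ _ (d_comp_augmentation_comp_f P)).Exact := by
  let φ : ShortComplex.mk (P.complex.d 1 0) P.augmentation P.complex_d_comp_π_f_zero ⟶
      ShortComplex.mk _ _ (d_comp_augmentation_comp_f P) :=
    { τ₁ := 𝟙 _, τ₂ := 𝟙 _, τ₃ := S.f }
  have : Epi φ.τ₁ := (inferInstance : Epi (𝟙 (P.complex.X 1)))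
  have : IsIso φ.τ₂ := (inferInstance : IsIso (𝟙 (P.complex.X 0)))
  have : Mono φ.τ₃ := hS.mono_f
  exact (ShortComplex.exact_iff_of_epi_of_isIso_of_mono φ).1 P.exact₀

/-- Splicing a projective resolution of `X₁` with a short exact sequence `0 ⟶ X₁ ⟶ X₂ ⟶ X₃ ⟶ 0`
whose middle term is projective gives a projective resolution of `X₃`. -/
noncomputable def spliceResolution (hS : S.ShortExact) [Projective S.X₂]
    (P : ProjectiveResolution S.X₁) : ProjectiveResolution S.X₃ where
  complex := P.complex.augment (P.augmentation ≫ S.f) (d_comp_augmentation_comp_f P)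
  projective
    | 0 => (inferInstance : Projective S.X₂)
    | n + 1 => P.projective n
  π := (ChainComplex.toSingle₀Equiv _ _).symm ⟨S.g, augmentation_comp_f_comp_g P⟩
  quasiIso := ⟨fun n => by
    match n with
    | 0 =>
      rw [ChainComplex.quasiIsoAt₀_iff, ShortComplex.quasiIso_iff_of_zeros' _ rfl rfl rfl]
      refine (ShortComplex.exact_and_epi_g_iff_of_iso ?_).2
        ⟨hS.exact_augmentation_comp_f P, hS.epi_g⟩
      exact ShortComplex.isoMk (Iso.refl _) (Iso.refl _) (Iso.refl _)
        ((Category.id_comp _).trans (Category.comp_id _).symm)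
        ((Category.id_comp S.g).trans <|
          (ChainComplex.toSingle₀Equiv_symm_apply_f_zero
            (C := P.complex.augment _ (d_comp_augmentation_comp_f P)) S.g
            (augmentation_comp_f_comp_g P)).symm.trans (Category.comp_id _).symm)
    | 1 =>
      rw [quasiIsoAt_iff_exactAt' _ _ (ChainComplex.exactAt_succ_single_obj _ _),
        HomologicalComplex.exactAt_iff' _ 2 1 0 (by simp) (by simp)]
      exact hS.exact_d_augmentation_comp_f P
    | n + 2 =>
      rw [quasiIsoAt_iff_exactAt' _ _ (ChainComplex.exactAt_succ_single_obj _ _),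
        HomologicalComplex.exactAt_iff' _ (n + 3) (n + 2) (n + 1) (by simp) (by simp)]
      exact P.exact_succ n⟩

end ShortComplex.ShortExact

/-- `Ext^(n + 1) X Y` vanishes iff every cocycle of a projective resolution is a coboundary. -/
lemma ProjectiveResolution.subsingleton_ext_succ_iff {R : Type*} [Ring R] [Linear R C]
    [EnoughProjectives C] {X : C} (P : ProjectiveResolution X) (Y : C) (n : ℕ) :
    Subsingleton (((Ext R C (n + 1)).obj (Opposite.op X)).obj Y) ↔
      ∀ h : P.complex.X (n + 1) ⟶ Y, P.complex.d (n + 2) (n + 1) ≫ h = 0 →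
        ∃ h' : P.complex.X n ⟶ Y, P.complex.d (n + 1) n ≫ h' = h := by
  rw [← ModuleCat.isZero_iff_subsingleton, (P.isoExt (R := R) (n + 1) Y).isZero_iff,
    ← HomologicalComplex.exactAt_iff_isZero_homology,
    HomologicalComplex.exactAt_iff' _ n (n + 1) (n + 2) (by simp) (by simp),
    ShortComplex.moduleCat_exact_iff]
  rfl

/-- Dimension shifting for the vanishing of `Ext`. -/
lemma ShortComplex.ShortExact.subsingleton_ext_succ_iff {R : Type*} [Ring R] [Linear R C]
    [EnoughProjectives C] {S : ShortComplex C} (hS : S.ShortExact) [Projective S.X₂]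
    (Y : C) (n : ℕ) :
    Subsingleton (((Ext R C (n + 2)).obj (Opposite.op S.X₃)).obj Y) ↔
      Subsingleton (((Ext R C (n + 1)).obj (Opposite.op S.X₁)).obj Y) := by
  let P := ProjectiveResolution.of S.X₁
  rw [(hS.spliceResolution P).subsingleton_ext_succ_iff, P.subsingleton_ext_succ_iff]
  rfl

end CategoryTheory

/-- The short complex of a pair of composable linear maps `0 → A → B → D → 0` with the first
injective, the second surjective, and exact in the middle, is short exact. -/
lemma ModuleCat.shortExact_of_exact {R : Type u} [Ring R] {A B D : Type u}
    [AddCommGroup A] [AddCommGroup B] [AddCommGroup D] [Module R A] [Module R B] [Module R D]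
    {i : A →ₗ[R] B} {π : B →ₗ[R] D} (hi : Function.Injective i) (hπ : Function.Surjective π)
    (h : Function.Exact i π) :
    (ShortComplex.mk (ModuleCat.ofHom i) (ModuleCat.ofHom π)
      (by ext x; exact h.apply_apply_eq_zero x)).ShortExact where
  exact := (ShortComplex.ShortExact.moduleCat_exact_iff_function_exact _).2 h
  mono_f := (ModuleCat.mono_iff_injective _).2 hi
  epi_g := (ModuleCat.epi_iff_surjective _).2 hπ

variable (Λ : Type u) [CommRing Λ]

/-- The dual of the transpose embeds in the source of the presentation. -/
noncomputable def dualTransposeMap (p q : ℕ) (f : (Fin p → Λ) →ₗ[Λ] (Fin q → Λ)) :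
    Module.Dual Λ (TransposeOf Λ p q f) →ₗ[Λ] (Fin p → Λ) :=
  (Module.evalEquiv Λ (Fin p → Λ)).symm.toLinearMap ∘ₗ (LinearMap.range f.dualMap).mkQ.dualMap

lemma dualTransposeMap_injective (p q : ℕ) (f : (Fin p → Λ) →ₗ[Λ] (Fin q → Λ)) :
    Function.Injective (dualTransposeMap Λ p q f) :=
  (Module.evalEquiv Λ (Fin p → Λ)).symm.injective.comp
    (LinearMap.dualMap_injective_of_surjective (Submodule.mkQ_surjective _))

lemma range_dualTransposeMap (p q : ℕ) (f : (Fin p → Λ) →ₗ[Λ] (Fin q → Λ)) :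
    LinearMap.range (dualTransposeMap Λ p q f) = LinearMap.ker f := by
  ext x
  rw [dualTransposeMap, LinearMap.range_comp, Submodule.range_dualMap_mkQ_eq,
    Submodule.mem_map_equiv, LinearEquiv.symm_symm, Submodule.mem_dualAnnihilator,
    LinearMap.mem_ker]
  constructor
  · intro h
    exact (Module.forall_dual_apply_eq_zero_iff Λ _).1 fun ψ => h _ ⟨ψ, rfl⟩
  · rintro h _ ⟨ψ, rfl⟩
    simp [h]

theorem stmt16 [IsArtinianRing Λ] [IsLocalRing Λ]
    (M : Type u) [AddCommGroup M] [Module Λ M] [Module.Finite Λ M]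
    (p q : ℕ) (f : (Fin p → Λ) →ₗ[Λ] (Fin q → Λ)) (g : (Fin q → Λ) →ₗ[Λ] M)
    (hg : Function.Surjective g) (hexact : LinearMap.range f = LinearMap.ker g)
    (hmin₀ : LinearMap.ker g ≤
      (IsLocalRing.maximalIdeal Λ) • (⊤ : Submodule Λ (Fin q → Λ)))
    (hmin₁ : LinearMap.ker f ≤
      (IsLocalRing.maximalIdeal Λ) • (⊤ : Submodule Λ (Fin p → Λ)))
    (hextΛ : ∀ i : ℕ, i = 1 ∨ i = 2 ∨ i = 3 →
      Subsingleton (ExtGrp Λ (ModuleCat.of Λ M) (ModuleCat.of Λ Λ) i)) :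
    Nonempty ((Module.Dual Λ (TransposeOf Λ p q f)) ≃ₗ[Λ] (LinearMap.ker f)) ∧
    (∃ ι : Module.Dual Λ (TransposeOf Λ p q f) →ₗ[Λ] (Fin p → Λ),
      Function.Injective ι ∧ LinearMap.range ι = LinearMap.ker f) ∧
    Subsingleton (ExtGrp Λ (ModuleCat.of Λ (Module.Dual Λ (TransposeOf Λ p q f)))
      (ModuleCat.of Λ Λ) 1) := by
  have hinj := dualTransposeMap_injective Λ p q f
  have hrange := range_dualTransposeMap Λ p q f
  refine ⟨⟨(LinearEquiv.ofInjective _ hinj).trans (LinearEquiv.ofEq _ _ hrange)⟩,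
    ⟨_, hinj, hrange⟩, ?_⟩
  let f' : (Fin p → Λ) →ₗ[Λ] LinearMap.ker g :=
    f.codRestrict _ fun x => hexact ▸ LinearMap.mem_range_self f x
  have hf' : Function.Surjective f' := by
    rintro ⟨y, hy⟩
    obtain ⟨x, rfl⟩ := hexact.symm ▸ hy
    exact ⟨x, rfl⟩
  have hkf' : Function.Exact (dualTransposeMap Λ p q f) f' := by
    rw [LinearMap.exact_iff, LinearMap.ker_codRestrict, hrange]
  have h₁ := ModuleCat.shortExact_of_exact hinj hf' hkf'
  have h₀ := ModuleCat.shortExact_of_exact (LinearMap.ker g).subtype_injective hg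
    (LinearMap.exact_subtype_ker_map g)
  have : Projective (ModuleCat.of Λ (Fin p → Λ)) :=
    (IsProjective.iff_projective _).1 inferInstance
  have : Projective (ModuleCat.of Λ (Fin q → Λ)) :=
    (IsProjective.iff_projective _).1 inferInstance
  exact (h₁.subsingleton_ext_succ_iff _ 0).1
    ((h₀.subsingleton_ext_succ_iff _ 1).1 (hextΛ 3 (by simp)))
end

section
/- Let Λ be an Artinian algebra, M a finitely generated Λ-module with no nonzero projective direct summands, and X a finitely generated Λ-module. If Ext¹_Λ(M, X) = 0, then every homomorphism X → D Tr M factors through an injective module, where D denotes the ordinary duality and Tr the transpose. -/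
open CategoryTheory

universe u

variable (K : Type u) [Field K] (Λ : Type u) [Ring Λ] [Algebra K Λ]

instance (priority := 100) algSMulComm : SMulCommClass Λ K Λ :=
  ⟨fun a k b => mul_smul_comm k a b⟩

variable (P : Type u) [AddCommGroup P] [Module Λ P]

/-- Right multiplication by `a` on the dual module `Hom_Λ(P, Λ)`, as a `K`-linear map. -/
def opSmul (a : Λ) : (P →ₗ[Λ] Λ) →ₗ[K] (P →ₗ[Λ] Λ) where
  toFun g := (MulOpposite.op a) • g
  map_add' g h := smul_add _ g h
  map_smul' k g := by
    ext x
    simp [MulOpposite.smul_eq_mul_unop, smul_mul_assoc]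

/-- The `K`-linear dual of the dual `Hom_Λ(P, Λ)`, i.e. the ordinary duality `D`
applied to the right `Λ`-module `Hom_Λ(P, Λ)`; it is a left `Λ`-module via
`(a • φ)(g) = φ(g · a)`. -/
instance dualSMul : SMul Λ ((P →ₗ[Λ] Λ) →ₗ[K] K) :=
  ⟨fun a φ => φ.comp (opSmul K Λ P a)⟩

lemma dual_smul_apply (a : Λ) (φ : (P →ₗ[Λ] Λ) →ₗ[K] K) (g : P →ₗ[Λ] Λ) :
    (a • φ) g = φ ((MulOpposite.op a) • g) := rfl

instance dualModule : Module Λ ((P →ₗ[Λ] Λ) →ₗ[K] K) where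
  smul a φ := φ.comp (opSmul K Λ P a)
  one_smul φ := by ext g; rw [dual_smul_apply]; simp
  mul_smul a b φ := by
    ext g
    rw [dual_smul_apply, dual_smul_apply, dual_smul_apply]
    congr 1
    rw [MulOpposite.op_mul, mul_smul]
  smul_zero a := rfl
  smul_add a φ ψ := rfl
  add_smul a b φ := by
    ext g
    rw [LinearMap.add_apply, dual_smul_apply, dual_smul_apply, dual_smul_apply,
      ← map_add]
    congr 1
    rw [MulOpposite.op_add, add_smul]
  zero_smul φ := by
    ext g
    rw [dual_smul_apply]
    simp

variable {Λ P} in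
lemma opSmul_comp {Q : Type u} [AddCommGroup Q] [Module Λ Q] (f : P →ₗ[Λ] Q)
    (a : Λ) (h : Q →ₗ[Λ] Λ) :
    (MulOpposite.op a • h).comp f = MulOpposite.op a • (h.comp f) := by
  ext x; simp

/-- `D Tr M`: the ordinary dual of the transpose of `M` (with respect to the finite
free presentation `f`), realized as the `Λ`-submodule of `D(P₁*)` consisting of
functionals vanishing on the image of `f* : P₀* → P₁*`. -/
def DTranspose (p q : ℕ) (f : (Fin p → Λ) →ₗ[Λ] (Fin q → Λ)) :
    Submodule Λ (((Fin p → Λ) →ₗ[Λ] Λ) →ₗ[K] K) where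
  carrier := {φ | ∀ h : (Fin q → Λ) →ₗ[Λ] Λ, φ (h.comp f) = 0}
  add_mem' := fun {φ ψ} hφ hψ h => by simp [hφ h, hψ h]
  zero_mem' := fun h => rfl
  smul_mem' := fun a φ hφ h => by
    rw [dual_smul_apply, ← opSmul_comp f a h]
    exact hφ _

/-- `M` has no nonzero projective direct summands. -/
def NoProjectiveSummands (M : Type u) [AddCommGroup M] [Module Λ M] : Prop :=
  ∀ A B : Submodule Λ M, IsCompl A B → Module.Projective Λ A → A = ⊥

section Extension

variable {C : Type*} [Category* C] [Abelian C] [EnoughProjectives C]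

/-- If `Ext¹(Z, X)` vanishes, then every `1`-cocycle on a projective resolution of `Z` with
values in `X` is a coboundary. -/
lemma exists_comp_eq_of_subsingleton_ext_one {Z X : C} (R : ProjectiveResolution Z)
    (hext : Subsingleton (((Ext ℤ C 1).obj (Opposite.op Z)).obj X))
    (c : R.complex.X 1 ⟶ X) (hc : R.complex.d 2 1 ≫ c = 0) :
    ∃ t : R.complex.X 0 ⟶ X, R.complex.d 1 0 ≫ t = c := by
  have hz := (ModuleCat.isZero_of_subsingleton
    (((Ext ℤ C 1).obj (Opposite.op Z)).obj X)).of_iso (R.isoExt 1 X).symm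
  rw [← HomologicalComplex.exactAt_iff_isZero_homology,
    HomologicalComplex.exactAt_iff' _ 0 1 2 (by simp) (by simp),
    ShortComplex.moduleCat_exact_iff] at hz
  exact hz c hc

end Extension

variable {Λ} in
/-- If `Ext¹(M, X)` vanishes and `g : F → M` is surjective with `F` projective,
then maps from the kernel of `g` to `X` extend to `F`. -/
lemma exists_extend_ker_of_subsingleton_ext_one {M X F : Type u} [AddCommGroup M] [Module Λ M]
    [AddCommGroup X] [Module Λ X] [AddCommGroup F] [Module Λ F] [Module.Projective Λ F]
    (hext : Subsingleton (ExtGrp Λ (ModuleCat.of Λ M) (ModuleCat.of Λ X) 1))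
    (g : F →ₗ[Λ] M) (hg : Function.Surjective g) (h : LinearMap.ker g →ₗ[Λ] X) :
    ∃ t : F →ₗ[Λ] X, ∀ k : LinearMap.ker g, t k = h k := by
  let R := projectiveResolution (ModuleCat.of Λ M)
  have projX (n : ℕ) : Module.Projective Λ (R.complex.X n) :=
    (IsProjective.iff_projective _).2 (R.projective n)
  let d₂ : R.complex.X 2 →ₗ[Λ] R.complex.X 1 := (R.complex.d 2 1).hom
  let d₁ : R.complex.X 1 →ₗ[Λ] R.complex.X 0 := (R.complex.d 1 0).hom
  let π : R.complex.X 0 →ₗ[Λ] M := (R.π.f 0).hom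
  have hπ : Function.Surjective π :=
    (ModuleCat.epi_iff_surjective (R.π.f 0)).1 inferInstance
  have hdd (x) : d₁ (d₂ x) = 0 :=
    congr($(R.complex.d_comp_d 2 1 0).hom x)
  have hdπ (x) : π (d₁ x) = 0 :=
    congr($(R.complex_d_comp_π_f_zero).hom x)
  have hker (x : R.complex.X 0) (hx : π x = 0) : ∃ y, d₁ y = x :=
    (ShortComplex.moduleCat_exact_iff _).1 R.exact₀ x hx
  obtain ⟨l, hl⟩ := Module.projective_lifting_property g π hg
  obtain ⟨r, hr⟩ := Module.projective_lifting_property π g hπ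
  have hl' (x) : g (l x) = π x := congr($hl x)
  have hr' (x) : π (r x) = g x := congr($hr x)
  let l₁ : R.complex.X 1 →ₗ[Λ] LinearMap.ker g :=
    (l ∘ₗ d₁).codRestrict _ fun x => by simp [hl', hdπ]
  obtain ⟨t, ht⟩ := exists_comp_eq_of_subsingleton_ext_one R hext (ModuleCat.ofHom (h ∘ₗ l₁)) (by
    ext x
    have : l₁ (d₂ x) = 0 := Subtype.ext (by simp [l₁, hdd])
    exact (congrArg h this).trans (map_zero h))
  have ht' (y) : t.hom (d₁ y) = h (l₁ y) := congr($(ht).hom y)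
  let e : F →ₗ[Λ] LinearMap.ker g :=
    (l ∘ₗ r - LinearMap.id).codRestrict _ fun x => by simp [hl', hr']
  refine ⟨t.hom ∘ₗ r - h ∘ₗ e, fun k => ?_⟩
  obtain ⟨y, hy⟩ := hker (r k) (by rw [hr']; exact k.2)
  have hy' : l₁ y = e k + k := Subtype.ext (by simp [l₁, e, hy])
  have : t.hom (r k) = h (e k) + h k := by rw [← hy, ht', hy', map_add]
  simp [this]

section Duality

variable {K Λ P}
variable {Y : Type u} [AddCommGroup Y] [Module Λ Y] [Module K Y] [IsScalarTower K Λ Y]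

lemma op_algebraMap_smul_hom (k : K) (u : P →ₗ[Λ] Λ) :
    MulOpposite.op (algebraMap K Λ k) • u = k • u := by
  ext x
  simp [Algebra.smul_def, Algebra.commutes]

lemma map_smul_dual_apply (φ : Y →ₗ[Λ] ((P →ₗ[Λ] Λ) →ₗ[K] K)) (k : K) (y : Y)
    (u : P →ₗ[Λ] Λ) : φ (k • y) u = k • φ y u := by
  rw [← algebraMap_smul Λ k y, map_smul, dual_smul_apply, op_algebraMap_smul_hom, map_smul]

/-- The functional on `Hom_Λ(Λⁿ, Y)` corresponding to a map `Y → D((Λⁿ)*)`. -/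
def toFunctional {n : ℕ} (φ : Y →ₗ[Λ] (((Fin n → Λ) →ₗ[Λ] Λ) →ₗ[K] K)) :
    ((Fin n → Λ) →ₗ[Λ] Y) →ₗ[K] K where
  toFun h := ∑ i, φ (h (Pi.single i 1)) (LinearMap.proj i)
  map_add' h h' := by simp [Finset.sum_add_distrib]
  map_smul' k h := by simp [map_smul_dual_apply, Finset.mul_sum]

/-- The map `Y → D(P*)` corresponding to a functional on `Hom_Λ(P, Y)`. -/
def ofFunctional (Ψ : (P →ₗ[Λ] Y) →ₗ[K] K) : Y →ₗ[Λ] ((P →ₗ[Λ] Λ) →ₗ[K] K) where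
  toFun y :=
    { toFun := fun u => Ψ (u.smulRight y)
      map_add' := fun u v => by
        rw [← map_add]; congr 1; ext; simp [add_smul]
      map_smul' := fun k u => by
        rw [RingHom.id_apply, ← map_smul]; congr 1; ext; simp }
  map_add' y z := by
    ext u
    change Ψ _ = Ψ _ + Ψ _
    rw [← map_add]; congr 1; ext; simp
  map_smul' a y := by
    ext u
    change Ψ _ = Ψ _
    congr 1
    refine LinearMap.ext fun x => ?_
    exact (mul_smul (u x) a y).symm

lemma ofFunctional_apply (Ψ : (P →ₗ[Λ] Y) →ₗ[K] K) (y : Y) (u : P →ₗ[Λ] Λ) :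
    ofFunctional Ψ y u = Ψ (u.smulRight y) := rfl

lemma sum_op_smul_proj {n : ℕ} (u : (Fin n → Λ) →ₗ[Λ] Λ) :
    ∑ i, MulOpposite.op (u (Pi.single i 1)) • (LinearMap.proj i : (Fin n → Λ) →ₗ[Λ] Λ) = u := by
  ext i
  simp [Pi.single_apply]

lemma toFunctional_smulRight {n : ℕ} (φ : Y →ₗ[Λ] (((Fin n → Λ) →ₗ[Λ] Λ) →ₗ[K] K))
    (y : Y) (u : (Fin n → Λ) →ₗ[Λ] Λ) : toFunctional φ (u.smulRight y) = φ y u := by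
  conv_rhs => rw [← sum_op_smul_proj u, map_sum]
  simp [toFunctional, dual_smul_apply]

lemma toFunctional_comp {p q : ℕ} (φ : Y →ₗ[Λ] (((Fin p → Λ) →ₗ[Λ] Λ) →ₗ[K] K))
    (f : (Fin p → Λ) →ₗ[Λ] (Fin q → Λ)) (h : (Fin q → Λ) →ₗ[Λ] Y) :
    toFunctional φ (h ∘ₗ f) = ∑ j, φ (h (Pi.single j 1)) (LinearMap.proj j ∘ₗ f) := by
  have : h ∘ₗ f = ∑ j, (LinearMap.proj j ∘ₗ f).smulRight (h (Pi.single j 1)) := by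
    refine LinearMap.ext fun x => ?_
    conv_lhs => rw [LinearMap.comp_apply, pi_eq_sum_univ' (f x)]
    simp [LinearMap.sum_apply]
  simp_rw [this, map_sum, toFunctional_smulRight]

/-- A linear functional vanishing on the kernel of a linear map factors through that map. -/
lemma exists_functional_comp_eq {V W : Type*} [AddCommGroup V] [Module K V] [AddCommGroup W]
    [Module K W] (T : V →ₗ[K] W) (Φ : V →ₗ[K] K) (hΦ : ∀ v, T v = 0 → Φ v = 0) :
    ∃ Ψ : W →ₗ[K] K, ∀ v, Ψ (T v) = Φ v := by
  have h : Φ ∈ LinearMap.range T.dualMap := by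
    rw [LinearMap.range_dualMap_eq_dualAnnihilator_ker, Submodule.mem_dualAnnihilator]
    exact hΦ
  obtain ⟨Ψ, rfl⟩ := h
  exact ⟨Ψ, fun v => rfl⟩

variable {Q : Type u} [AddCommGroup Q] [Module Λ Q]

/-- Precomposition with a `Λ`-linear map, as a `K`-linear map on Hom spaces. -/
def precomp (Y : Type u) [AddCommGroup Y] [Module Λ Y] [Module K Y] [IsScalarTower K Λ Y]
    (s : P →ₗ[Λ] Q) : (Q →ₗ[Λ] Y) →ₗ[K] (P →ₗ[Λ] Y) where
  toFun h := h ∘ₗ s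
  map_add' _ _ := rfl
  map_smul' _ _ := rfl

end Duality

/-- The dual `D((Λⁿ)*)` of a finite free right module is injective. -/
lemma injective_dual_free (n : ℕ) :
    Module.Injective Λ (((Fin n → Λ) →ₗ[Λ] Λ) →ₗ[K] K) where
  out Y Z _ _ _ _ i hi φ := by
    let : Module K Y := Module.compHom Y (algebraMap K Λ)
    let : Module K Z := Module.compHom Z (algebraMap K Λ)
    have : IsScalarTower K Λ Y := .of_algebraMap_smul fun _ _ => rfl
    have : IsScalarTower K Λ Z := .of_algebraMap_smul fun _ _ => rfl
    let T : ((Fin n → Λ) →ₗ[Λ] Y) →ₗ[K] ((Fin n → Λ) →ₗ[Λ] Z) :=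
      { toFun := fun h => i ∘ₗ h
        map_add' := fun h h' => LinearMap.comp_add _ _ _
        map_smul' := fun k h => LinearMap.ext fun x => i.map_smul (algebraMap K Λ k) (h x) }
    obtain ⟨Ψ, hΨ⟩ := exists_functional_comp_eq T (toFunctional φ) fun h hh => by
      have : h = 0 := LinearMap.ext fun x => hi (congr($hh x).trans (map_zero i).symm)
      rw [this, map_zero]
    refine ⟨ofFunctional Ψ, fun y => LinearMap.ext fun u => ?_⟩
    rw [← toFunctional_smulRight φ, ← hΨ, ofFunctional_apply]
    congr 1
    refine LinearMap.ext fun x => ?_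
    simp [T]

variable {Λ P} in
/-- The `Λ`-linear map `D(P*) → D(Q*)` induced by a linear map `P → Q`. -/
def dualStarMap {Q : Type u} [AddCommGroup Q] [Module Λ Q] (s : P →ₗ[Λ] Q) :
    ((P →ₗ[Λ] Λ) →ₗ[K] K) →ₗ[Λ] ((Q →ₗ[Λ] Λ) →ₗ[K] K) where
  toFun θ := θ ∘ₗ precomp Λ s
  map_add' _ _ := rfl
  map_smul' a θ := by
    ext v
    exact congrArg θ (opSmul_comp s a v).symm


theorem stmt19 [FiniteDimensional K Λ]
    (M : Type u) [AddCommGroup M] [Module Λ M] [Module.Finite Λ M]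
    (hM : NoProjectiveSummands Λ M)
    (p q : ℕ) (f : (Fin p → Λ) →ₗ[Λ] (Fin q → Λ)) (g : (Fin q → Λ) →ₗ[Λ] M)
    (hg : Function.Surjective g) (hexact : LinearMap.range f = LinearMap.ker g)
    (X : Type u) [AddCommGroup X] [Module Λ X] [Module.Finite Λ X]
    (hext : Subsingleton (ExtGrp Λ (ModuleCat.of Λ M) (ModuleCat.of Λ X) 1)) :
    ∀ φ : X →ₗ[Λ] (DTranspose K Λ p q f),
      ∃ I : ModuleCat.{u} Λ, Module.Injective Λ I ∧
        ∃ (α : X →ₗ[Λ] I) (β : I →ₗ[Λ] (DTranspose K Λ p q f)),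
          β.comp α = φ := by
  intro φ
  let : Module K X := Module.compHom X (algebraMap K Λ)
  have : IsScalarTower K Λ X := .of_algebraMap_smul fun _ _ => rfl
  have : IsNoetherianRing Λ := isNoetherian_of_tower K inferInstance
  obtain ⟨r, s₀, hs₀⟩ := Module.Finite.exists_fin' Λ (LinearMap.ker f)
  let s : (Fin r → Λ) →ₗ[Λ] (Fin p → Λ) := (LinearMap.ker f).subtype ∘ₗ s₀
  have hfs : f ∘ₗ s = 0 := LinearMap.ext fun x => (s₀ x).2
  let φ' : X →ₗ[Λ] (((Fin p → Λ) →ₗ[Λ] Λ) →ₗ[K] K) := (DTranspose K Λ p q f).subtype ∘ₗ φ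
  have hvanish : ∀ h : (Fin p → Λ) →ₗ[Λ] X, precomp (K := K) X s h = 0 →
      toFunctional φ' h = 0 := by
    intro h hh
    have hker : LinearMap.ker f ≤ LinearMap.ker h := by
      intro x hx
      obtain ⟨y, hy⟩ := hs₀ ⟨x, hx⟩
      have : s y = x := congrArg Subtype.val hy
      rw [LinearMap.mem_ker, ← this]
      exact congr($hh y)
    let f' : (Fin p → Λ) →ₗ[Λ] LinearMap.ker g :=
      f.codRestrict _ fun x => hexact ▸ LinearMap.mem_range_self f x
    have hf' : Function.Surjective f' := by
      rintro ⟨y, hy⟩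
      obtain ⟨x, rfl⟩ := hexact.symm ▸ hy
      exact ⟨x, rfl⟩
    have hkf' : LinearMap.ker f' ≤ LinearMap.ker h := by
      rwa [LinearMap.ker_codRestrict]
    let h' : LinearMap.ker g →ₗ[Λ] X :=
      (LinearMap.ker f').liftQ h hkf' ∘ₗ (f'.quotKerEquivOfSurjective hf').symm.toLinearMap
    have hh' (x) : h' (f' x) = h x := by
      have : (f'.quotKerEquivOfSurjective hf').symm (f' x) = Submodule.Quotient.mk x := by
        rw [LinearEquiv.symm_apply_eq]; rfl
      simp [h', this]
    obtain ⟨t, ht⟩ := exists_extend_ker_of_subsingleton_ext_one hext g hg h'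
    have hth : h = t ∘ₗ f := LinearMap.ext fun x => ((ht (f' x)).trans (hh' x)).symm
    rw [hth, toFunctional_comp]
    exact Finset.sum_eq_zero fun j _ => (φ (t (Pi.single j 1))).2 _
  obtain ⟨Ψ, hΨ⟩ := exists_functional_comp_eq (precomp X s) (toFunctional φ') hvanish
  let β : (((Fin r → Λ) →ₗ[Λ] Λ) →ₗ[K] K) →ₗ[Λ] DTranspose K Λ p q f :=
    (dualStarMap K s).codRestrict _ fun θ h => by
      change θ ((h ∘ₗ f) ∘ₗ s) = 0
      rw [LinearMap.comp_assoc, hfs, LinearMap.comp_zero, map_zero]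
  refine ⟨ModuleCat.of Λ (((Fin r → Λ) →ₗ[Λ] Λ) →ₗ[K] K), injective_dual_free K Λ r,
    ofFunctional Ψ, β, LinearMap.ext fun x => Subtype.ext (LinearMap.ext fun v => ?_)⟩
  calc Ψ ((v ∘ₗ s).smulRight x) = toFunctional φ' (v.smulRight x) := hΨ (v.smulRight x)
    _ = φ' x v := toFunctional_smulRight φ' x v
end
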